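/- Let {X_n}_{n≥1} be a two-state correlated random walk on {1,-1} with parameters 0<p,q<1, p≠q, started from the stationary distribution. Let A,B be positive integers, S_n = X_1+···+X_n, τ = inf{k : S_k = A or S_k = -B}, and α = P(S_τ = A). Then α = [ (q/p)^{-B}·√((1-q)q/((1-p)p)) - (√((1-q)(1-p))/(2-p-q))·(√(q/p)+√(p/q)) ] / [ (q/p)^{-B}·√((1-q)q/((1-p)p)) - (q/p)^{A}·√((1-p)p/((1-q)q)) ]. -/

import Mathlib

open MeasureTheory ProbabilityTheory Set

noncomputable section

variable {Ω : Type*} [MeasurableSpace Ω]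

/-- The σ-algebra `σ(X_1, …, X_n)` generated by the first `n` steps of the process. -/
def sigmaUpTo (X : ℕ → Ω → ℝ) (n : ℕ) : MeasurableSpace Ω :=
  ⨆ i ∈ Finset.Icc 1 n, MeasurableSpace.comap (X i) inferInstance

/-- The transition kernel of a two-state correlated random walk on `{1, -1}`:
from state `1` go to `1` with probability `p`; from state `-1` go to `-1`
with probability `q`. -/
def crwKernel (p q : ℝ) (i j : ℝ) : ℝ :=
  if i = 1 then (if j = 1 then p else 1 - p)
  else (if j = -1 then q else 1 - q)

/-- `X` is a two-state correlated random walk on `{1, -1}` with parameters `p, q`,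
started from the stationary distribution `((1-q)/(2-p-q), (1-p)/(2-p-q))`:
each `X n` (for `n ≥ 1`) is measurable with values in `{1, -1}`, the initial
distribution is stationary, and the Markov property with the prescribed
time-homogeneous transition probabilities holds, conditionally on
`F n = σ(X_1, …, X_n)`. -/
def IsCRW (μ : Measure Ω) (X : ℕ → Ω → ℝ) (p q : ℝ) : Prop :=
  (∀ i, 1 ≤ i → Measurable (X i)) ∧
  (∀ n, 1 ≤ n → ∀ ω, X n ω = 1 ∨ X n ω = -1) ∧
  (μ {ω | X 1 ω = 1} = ENNReal.ofReal ((1 - q) / (2 - p - q))) ∧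
  (∀ n, 1 ≤ n → ∀ i ∈ ({1, -1} : Set ℝ), ∀ j ∈ ({1, -1} : Set ℝ),
    ∀ E : Set Ω, MeasurableSet[sigmaUpTo X n] E →
      μ (E ∩ {ω | X n ω = i ∧ X (n + 1) ω = j})
        = ENNReal.ofReal (crwKernel p q i j) * μ (E ∩ {ω | X n ω = i}))

/-- The partial sums `X 1 + ⋯ + X n`. -/
def partialSum (X : ℕ → Ω → ℝ) (n : ℕ) (ω : Ω) : ℝ := ∑ i ∈ Finset.Icc 1 n, X i ω

/-- The event that the partial sums avoid both barriers `A` and `-B` up to time `n`. -/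
def surviveSet (X : ℕ → Ω → ℝ) (A B n : ℕ) : Set Ω :=
  {ω | ∀ k ≤ n, partialSum X k ω ≠ A ∧ partialSum X k ω ≠ -(B : ℝ)}

/-- The time at which one of the barriers `A`, `-B` is first hit (`0` if this never happens). -/
def exitTime (X : ℕ → Ω → ℝ) (A B : ℕ) (ω : Ω) : ℕ :=
  sInf {k | partialSum X k ω = (A : ℝ) ∨ partialSum X k ω = -(B : ℝ)}

/-- The event that the barrier `A` is hit before `-B`. -/
def exitUpper (X : ℕ → Ω → ℝ) (A B : ℕ) : Set Ω :=
  {ω | partialSum X (exitTime X A B ω) ω = (A : ℝ)}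

/-- The function `F` of the current position after an up-step, and `G` after a down-step. -/
def stateValue (X : ℕ → Ω → ℝ) (F G : ℝ → ℝ) (n : ℕ) (ω : Ω) : ℝ :=
  if X n ω = 1 then F (partialSum X n ω) else G (partialSum X n ω)

/-- The up-step indicator at time `n + 1`, centred given the past. -/
def innovation (X : ℕ → Ω → ℝ) (p q : ℝ) (n : ℕ) (ω : Ω) : ℝ :=
  (if X (n + 1) ω = 1 then 1 else 0) - (if X n ω = 1 then p else 1 - q)

section Path

omit [MeasurableSpace Ω]

variable {X : ℕ → Ω → ℝ} {A B n : ℕ} {ω : Ω}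

lemma partialSum_zero : partialSum X 0 ω = 0 := by simp [partialSum]

lemma partialSum_succ : partialSum X (n + 1) ω = partialSum X n ω + X (n + 1) ω := by
  simp [partialSum, Finset.sum_Icc_succ_top]

lemma surviveSet_succ_subset : surviveSet X A B (n + 1) ⊆ surviveSet X A B n :=
  fun _ h k hk => h k (hk.trans n.le_succ)

lemma mem_surviveSet_zero (hA : 0 < A) (hB : 0 < B) : ω ∈ surviveSet X A B 0 := by
  intro k hk
  obtain rfl : k = 0 := by omega
  rw [partialSum_zero]
  have h1 : (0 : ℝ) < A := by exact_mod_cast hA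
  have h2 : (0 : ℝ) < B := by exact_mod_cast hB
  exact ⟨h1.ne, (neg_lt_zero.2 h2).ne'⟩

lemma exists_int_of_mem_surviveSet (hX : ∀ n, 1 ≤ n → ∀ ω, X n ω = 1 ∨ X n ω = -1)
    (hA : 0 < A) (hB : 0 < B) (h : ω ∈ surviveSet X A B n) :
    ∃ z : ℤ, partialSum X n ω = z ∧ -(B : ℤ) < z ∧ z < A := by
  induction n with
  | zero => exact ⟨0, by simp [partialSum_zero], by omega, by omega⟩
  | succ n ih =>
    obtain ⟨z, hz, h1, h2⟩ := ih (surviveSet_succ_subset h)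
    obtain ⟨hA', hB'⟩ := h (n + 1) le_rfl
    rw [partialSum_succ, hz] at hA' hB' ⊢
    rcases hX (n + 1) (by omega) ω with hx | hx <;> rw [hx] at hA' hB' ⊢
    · refine ⟨z + 1, by push_cast; ring, by omega, ?_⟩
      have : z + 1 ≠ (A : ℤ) := by exact_mod_cast hA'
      omega
    · refine ⟨z - 1, by push_cast; ring, ?_, by omega⟩
      have : z - 1 ≠ -(B : ℤ) := by
        intro h; apply hB'; have := congrArg (Int.cast : ℤ → ℝ) h; push_cast at this; linarith
      omega

lemma partialSum_bounds_of_mem_surviveSet (hX : ∀ n, 1 ≤ n → ∀ ω, X n ω = 1 ∨ X n ω = -1)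
    (hA : 0 < A) (hB : 0 < B) (h : ω ∈ surviveSet X A B n) :
    -(B : ℝ) + 1 ≤ partialSum X n ω ∧ partialSum X n ω ≤ A - 1 := by
  obtain ⟨z, hz, h1, h2⟩ := exists_int_of_mem_surviveSet hX hA hB h
  have h1' : -(B : ℤ) + 1 ≤ z := by omega
  have h2' : z ≤ (A : ℤ) - 1 := by omega
  rw [hz]
  exact ⟨by exact_mod_cast h1', by exact_mod_cast h2'⟩

lemma exitTime_eq_of_mem_of_notMem (h : ω ∈ surviveSet X A B n)
    (h' : ω ∉ surviveSet X A B (n + 1)) :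
    exitTime X A B ω = n + 1 ∧
      (partialSum X (n + 1) ω = A ∨ partialSum X (n + 1) ω = -(B : ℝ)) := by
  have hit : partialSum X (n + 1) ω = A ∨ partialSum X (n + 1) ω = -(B : ℝ) := by
    by_contra! hc
    refine h' fun k hk => ?_
    rcases Nat.le_succ_iff.1 hk with hk | rfl
    exacts [h k hk, hc]
  refine ⟨le_antisymm (Nat.sInf_le hit) (le_csInf ⟨_, hit⟩ fun k hk => ?_), hit⟩
  by_contra! hlt
  have := h k (by omega)
  rcases hk with hk | hk
  exacts [this.1 hk, this.2 hk]

lemma exitUpper_eq_iUnion (hA : 0 < A) (hB : 0 < B) :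
    exitUpper X A B = ⋃ n, surviveSet X A B n ∩ {ω | partialSum X (n + 1) ω = A} := by
  ext ω
  simp only [mem_iUnion, mem_inter_iff, mem_ofPred_eq]
  constructor
  · intro h
    have hτ : exitTime X A B ω ≠ 0 := by
      intro h0
      rw [exitUpper, mem_ofPred_eq, h0] at h
      exact (mem_surviveSet_zero hA hB 0 le_rfl).1 h
    obtain ⟨n, hn⟩ := Nat.exists_eq_succ_of_ne_zero hτ
    rw [exitUpper, mem_ofPred_eq, hn] at h
    refine ⟨n, fun k hk => ?_, h⟩
    have := Nat.notMem_of_lt_sInf (show k < exitTime X A B ω by omega)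
    simpa [not_or] using this
  · rintro ⟨n, h, hn⟩
    have h' : ω ∉ surviveSet X A B (n + 1) := fun hs => (hs _ le_rfl).1 hn
    rw [exitUpper, mem_ofPred_eq, (exitTime_eq_of_mem_of_notMem h h').1, hn]

open Classical in
lemma stateValue_eq_of_exit (hX : ∀ n, 1 ≤ n → ∀ ω, X n ω = 1 ∨ X n ω = -1)
    (hA : 0 < A) (hB : 0 < B) (F G : ℝ → ℝ) (h : ω ∈ surviveSet X A B n)
    (h' : ω ∉ surviveSet X A B (n + 1)) :
    stateValue X F G (n + 1) ω = if ω ∈ exitUpper X A B then F A else G (-(B : ℝ)) := by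
  obtain ⟨hτ, hit⟩ := exitTime_eq_of_mem_of_notMem h h'
  obtain ⟨h1, h2⟩ := partialSum_bounds_of_mem_surviveSet hX hA hB h
  have hA1 : (0 : ℝ) < A := by exact_mod_cast hA
  have hB1 : (0 : ℝ) < B := by exact_mod_cast hB
  have hs : partialSum X (n + 1) ω = _ := partialSum_succ
  rcases hit with hit | hit <;>
    rcases hX (n + 1) (by omega) ω with hx | hx <;>
    simp only [stateValue, exitUpper, mem_ofPred_eq, hτ, hit, hx]
  · simp
  · rw [hs, hx] at hit; linarith
  · rw [hs, hx] at hit; linarith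
  · rw [if_neg (by norm_num), if_neg (by linarith)]

lemma stateValue_succ_sub (hX : ∀ n, 1 ≤ n → ∀ ω, X n ω = 1 ∨ X n ω = -1) {p q m : ℝ}
    {F G : ℝ → ℝ} (hF : ∀ s, p * F (s + 1) + (1 - p) * G (s - 1) = F s + m)
    (hG : ∀ s, (1 - q) * F (s + 1) + q * G (s - 1) = G s + m) (hn : 1 ≤ n) :
    stateValue X F G (n + 1) ω - stateValue X F G n ω
      = (F (partialSum X n ω + 1) - G (partialSum X n ω - 1)) * innovation X p q n ω + m := by
  have hF' := hF (partialSum X n ω)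
  have hG' := hG (partialSum X n ω)
  have hne : ¬ (-1 : ℝ) = 1 := by norm_num
  simp only [stateValue, innovation, partialSum_succ (n := n)]
  rcases hX (n + 1) (by omega) ω with hx | hx <;> rcases hX n hn ω with hy | hy <;>
    simp only [hx, hy, if_true, hne, if_false, ← sub_eq_add_neg] <;> linarith

open Classical in
lemma stateValue_one_add_sum (hX : ∀ n, 1 ≤ n → ∀ ω, X n ω = 1 ∨ X n ω = -1)
    (hA : 0 < A) (hB : 0 < B) (F G : ℝ → ℝ) (ω : Ω) (K : ℕ) :
    stateValue X F G 1 ω + ∑ k ∈ Finset.range K, (surviveSet X A B (k + 1)).indicator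
        (fun ω => stateValue X F G (k + 2) ω - stateValue X F G (k + 1) ω) ω
      = if ω ∈ surviveSet X A B (K + 1) then stateValue X F G (K + 1) ω
        else if ω ∈ exitUpper X A B then F A else G (-(B : ℝ)) := by
  induction K with
  | zero =>
    split_ifs with h
    · simp
    all_goals
      simpa [*] using stateValue_eq_of_exit hX hA hB F G (mem_surviveSet_zero hA hB) h
  | succ K ih =>
    rw [Finset.sum_range_succ, ← add_assoc, ih]
    by_cases h : ω ∈ surviveSet X A B (K + 1)
    · rw [if_pos h, indicator_of_mem h, add_sub_cancel]
      split_ifs with h1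
      · rfl
      all_goals simpa [*] using stateValue_eq_of_exit hX hA hB F G h h1
    · rw [if_neg h, indicator_of_notMem h, add_zero,
        if_neg fun h1 => h (surviveSet_succ_subset h1)]

end Path

section Probability

variable {μ : Measure Ω} {X : ℕ → Ω → ℝ} {p q : ℝ} {A B n : ℕ}

lemma sigmaUpTo_le (hX : ∀ i, 1 ≤ i → Measurable (X i)) (n : ℕ) :
    sigmaUpTo X n ≤ ‹MeasurableSpace Ω› :=
  iSup₂_le fun i hi => (hX i (Finset.mem_Icc.1 hi).1).comap_le

omit [MeasurableSpace Ω] in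
lemma measurable_sigmaUpTo {i : ℕ} (h1 : 1 ≤ i) (hi : i ≤ n) :
    Measurable[sigmaUpTo X n] (X i) :=
  Measurable.of_comap_le
    (le_iSup₂_of_le (f := fun i (_ : i ∈ Finset.Icc 1 n) =>
      MeasurableSpace.comap (X i) inferInstance) i (Finset.mem_Icc.2 ⟨h1, hi⟩) le_rfl)

omit [MeasurableSpace Ω] in
lemma measurable_partialSum_sigmaUpTo {k : ℕ} (hk : k ≤ n) :
    Measurable[sigmaUpTo X n] (partialSum X k) := by
  refine Finset.measurable_fun_sum _ fun i hi => ?_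
  rw [Finset.mem_Icc] at hi
  exact measurable_sigmaUpTo hi.1 (hi.2.trans hk)

omit [MeasurableSpace Ω] in
lemma measurableSet_surviveSet_sigmaUpTo :
    MeasurableSet[sigmaUpTo X n] (surviveSet X A B n) := by
  have : surviveSet X A B n
      = ⋂ k, ⋂ (_ : k ≤ n), partialSum X k ⁻¹' ({(A : ℝ), -(B : ℝ)}ᶜ) := by
    ext ω
    simp [surviveSet, not_or]
  rw [this]
  exact MeasurableSet.iInter fun k => MeasurableSet.iInter fun hk =>
    measurable_partialSum_sigmaUpTo hk
      ((measurableSet_singleton _).insert _).compl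

lemma measurable_partialSum (hX : ∀ i, 1 ≤ i → Measurable (X i)) (n : ℕ) :
    Measurable (partialSum X n) :=
  (measurable_partialSum_sigmaUpTo le_rfl).mono (sigmaUpTo_le hX n) le_rfl

lemma measurableSet_surviveSet (hX : ∀ i, 1 ≤ i → Measurable (X i)) :
    MeasurableSet (surviveSet X A B n) :=
  sigmaUpTo_le hX n _ measurableSet_surviveSet_sigmaUpTo

lemma measurableSet_exitUpper (hX : ∀ i, 1 ≤ i → Measurable (X i)) (hA : 0 < A) (hB : 0 < B) :
    MeasurableSet (exitUpper X A B) := by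
  rw [exitUpper_eq_iUnion hA hB]
  exact MeasurableSet.iUnion fun n => (measurableSet_surviveSet hX).inter
    (measurable_partialSum hX _ (measurableSet_singleton _))

lemma measurable_innovation (hX : ∀ i, 1 ≤ i → Measurable (X i)) (hn : 1 ≤ n) :
    Measurable (innovation X p q n) :=
  (Measurable.ite (hX (n + 1) (by omega) (measurableSet_singleton 1))
    measurable_const measurable_const).sub
  (Measurable.ite (hX n hn (measurableSet_singleton 1)) measurable_const measurable_const)

omit [MeasurableSpace Ω] in
lemma abs_innovation_le (hp0 : 0 < p) (hp1 : p < 1) (hq0 : 0 < q) (hq1 : q < 1) (ω : Ω) :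
    |innovation X p q n ω| ≤ 1 := by
  rw [innovation, abs_le]
  split_ifs <;> constructor <;> linarith

lemma IsCRW.measureReal_inter_up [IsProbabilityMeasure μ] (hX : IsCRW μ X p q) (hp0 : 0 < p)
    (hq1 : q < 1) (hn : 1 ≤ n) {E : Set Ω} (hE : MeasurableSet[sigmaUpTo X n] E) :
    μ.real (E ∩ {ω | X (n + 1) ω = 1})
      = p * μ.real (E ∩ {ω | X n ω = 1}) + (1 - q) * μ.real (E \ {ω | X n ω = 1}) := by
  obtain ⟨hm, hv, -, hM⟩ := hX
  have hne : ¬ (-1 : ℝ) = 1 := by norm_num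
  have h1ne : ¬ (1 : ℝ) = -1 := by norm_num
  have key1 := congrArg ENNReal.toReal (hM n hn 1 (by simp) 1 (by simp) E hE)
  have key2 := congrArg ENNReal.toReal (hM n hn (-1) (by simp) 1 (by simp) E hE)
  simp only [crwKernel, if_true, hne, h1ne, if_false, ENNReal.toReal_mul] at key1 key2
  rw [ENNReal.toReal_ofReal hp0.le] at key1
  rw [ENNReal.toReal_ofReal (by linarith)] at key2
  have e : E \ {ω | X n ω = 1} = E ∩ {ω | X n ω = -1} := by
    ext ω
    rcases hv n hn ω with h | h <;> simp [h, hne, h1ne]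
  have hset : MeasurableSet {ω | X n ω = 1} := hm n hn (measurableSet_singleton 1)
  rw [e]
  simp only [measureReal_def]
  rw [← key1, ← key2]
  simp only [← measureReal_def]
  rw [← measureReal_inter_add_sdiff (s := E ∩ {ω | X (n + 1) ω = 1}) hset]
  congr 2 <;> ext ω <;> rcases hv n hn ω with h | h <;> simp [h, hne, h1ne]

lemma IsCRW.setIntegral_innovation [IsProbabilityMeasure μ] (hX : IsCRW μ X p q) (hp0 : 0 < p)
    (hq1 : q < 1) (hn : 1 ≤ n) {E : Set Ω} (hE : MeasurableSet[sigmaUpTo X n] E) :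
    ∫ ω in E, innovation X p q n ω ∂μ = 0 := by
  have hm := hX.1
  have hup : MeasurableSet {ω | X (n + 1) ω = 1} := hm _ (by omega) (measurableSet_singleton 1)
  have hcur : MeasurableSet {ω | X n ω = 1} := hm n hn (measurableSet_singleton 1)
  have e : innovation X p q n = fun ω => {ω | X (n + 1) ω = 1}.indicator (fun _ => (1 : ℝ)) ω
      - ({ω | X n ω = 1}.indicator (fun _ => p) ω
        + {ω | X n ω = 1}ᶜ.indicator (fun _ => 1 - q) ω) := by
    ext ω
    by_cases h : X n ω = 1 <;> simp [innovation, indicator, h]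
  have hi : ∀ (s : Set Ω) (c : ℝ), MeasurableSet s →
      Integrable (s.indicator fun _ => c) (μ.restrict E) :=
    fun s c hs => (integrable_const c).indicator hs
  have hadd : Integrable (fun ω => {ω | X n ω = 1}.indicator (fun _ => p) ω
      + {ω | X n ω = 1}ᶜ.indicator (fun _ => 1 - q) ω) (μ.restrict E) :=
    (hi _ _ hcur).add (hi _ _ hcur.compl)
  rw [e]
  dsimp only
  rw [integral_sub (hi _ _ hup) hadd, integral_add (hi _ _ hcur) (hi _ _ hcur.compl),
    integral_indicator_const _ hup,
    integral_indicator_const _ hcur, integral_indicator_const _ hcur.compl,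
    measureReal_restrict_apply hup, measureReal_restrict_apply hcur,
    measureReal_restrict_apply hcur.compl, inter_comm _ E, inter_comm _ E, inter_comm _ E,
    ← sdiff_eq, hX.measureReal_inter_up hp0 hq1 hn hE]
  simp only [smul_eq_mul]
  ring

lemma integrable_of_bounded [IsProbabilityMeasure μ] {f : Ω → ℝ} (hf : Measurable f) {C : ℝ}
    (hC : ∀ ω, |f ω| ≤ C) : Integrable f μ :=
  Integrable.of_bound hf.aestronglyMeasurable C (Filter.Eventually.of_forall hC)

lemma IsCRW.integral_mul_innovation [IsProbabilityMeasure μ] (hX : IsCRW μ X p q) (hp0 : 0 < p)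
    (hp1 : p < 1) (hq0 : 0 < q) (hq1 : q < 1) (hn : 1 ≤ n) {Y : Ω → ℝ}
    (hY : Measurable[sigmaUpTo X n] Y) {C : ℝ} (hC : ∀ ω, |Y ω| ≤ C) :
    Integrable (Y * innovation X p q n) μ ∧ ∫ ω, (Y * innovation X p q n) ω ∂μ = 0 := by
  have hle := sigmaUpTo_le hX.1 n
  have hD := measurable_innovation (p := p) (q := q) hX.1 hn
  have hDi : Integrable (innovation X p q n) μ :=
    integrable_of_bounded hD (abs_innovation_le hp0 hp1 hq0 hq1)
  have hYD : Integrable (Y * innovation X p q n) μ := by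
    refine integrable_of_bounded (C := C) ((hY.mono hle le_rfl).mul hD) fun ω => ?_
    rw [Pi.mul_apply, abs_mul]
    exact (mul_le_of_le_one_right (abs_nonneg _) (abs_innovation_le hp0 hp1 hq0 hq1 ω)).trans
      (hC ω)
  have h0 : (0 : Ω → ℝ) =ᵐ[μ] μ[innovation X p q n | sigmaUpTo X n] :=
    ae_eq_condExp_of_forall_setIntegral_eq hle hDi
      (fun s _ _ => (integrable_zero Ω ℝ μ).integrableOn)
      (fun s hs _ => by simp [hX.setIntegral_innovation hp0 hq1 hn hs])
      stronglyMeasurable_zero.aestronglyMeasurable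
  refine ⟨hYD, ?_⟩
  rw [← integral_condExp hle]
  refine integral_eq_zero_of_ae ?_
  filter_upwards [condExp_mul_of_stronglyMeasurable_left hY.stronglyMeasurable hYD hDi, h0]
    with ω h1 h2
  rw [h1, Pi.mul_apply, ← h2]
  simp

lemma measurable_stateValue (hX : ∀ i, 1 ≤ i → Measurable (X i)) {F G : ℝ → ℝ}
    (hF : Measurable F) (hG : Measurable G) (hn : 1 ≤ n) : Measurable (stateValue X F G n) :=
  Measurable.ite (hX n hn (measurableSet_singleton 1)) (hF.comp (measurable_partialSum hX n))
    (hG.comp (measurable_partialSum hX n))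

lemma IsCRW.integral_stateValue_one [IsProbabilityMeasure μ] (hX : IsCRW μ X p q)
    (hp1 : p < 1) (hq1 : q < 1) (F G : ℝ → ℝ) :
    Integrable (stateValue X F G 1) μ ∧ ∫ ω, stateValue X F G 1 ω ∂μ
      = (1 - q) / (2 - p - q) * F 1 + (1 - p) / (2 - p - q) * G (-1) := by
  obtain ⟨hm, hv, hinit, -⟩ := hX
  have hset : MeasurableSet {ω | X 1 ω = 1} := hm 1 le_rfl (measurableSet_singleton 1)
  have hne : ¬ (-1 : ℝ) = 1 := by norm_num
  have e : stateValue X F G 1 = fun ω => {ω | X 1 ω = 1}.indicator (fun _ => F 1) ω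
      + {ω | X 1 ω = 1}ᶜ.indicator (fun _ => G (-1)) ω := by
    ext ω
    rcases hv 1 le_rfl ω with h | h <;> simp [stateValue, partialSum, h, hne]
  have h1 : μ.real {ω | X 1 ω = 1} = (1 - q) / (2 - p - q) := by
    rw [measureReal_def, hinit, ENNReal.toReal_ofReal]
    exact div_nonneg (by linarith) (by linarith)
  have hi1 : Integrable ({ω | X 1 ω = 1}.indicator fun _ => F 1) μ :=
    (integrable_const _).indicator hset
  have hi2 : Integrable ({ω | X 1 ω = 1}ᶜ.indicator fun _ => G (-1)) μ :=
    (integrable_const _).indicator hset.compl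
  rw [e]
  refine ⟨hi1.add hi2, ?_⟩
  rw [integral_add hi1 hi2, integral_indicator_const _ hset,
    integral_indicator_const _ hset.compl, probReal_compl_eq_one_sub hset, h1]
  have : 2 - p - q ≠ 0 := by linarith
  simp only [smul_eq_mul]
  field_simp
  ring

lemma IsCRW.integral_indicator_stateValue_sub [IsProbabilityMeasure μ] (hX : IsCRW μ X p q)
    (hp0 : 0 < p) (hp1 : p < 1) (hq0 : 0 < q) (hq1 : q < 1) (hA : 0 < A) (hB : 0 < B)
    {m C : ℝ} {F G : ℝ → ℝ} (hFm : Measurable F) (hGm : Measurable G)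
    (hF : ∀ s, p * F (s + 1) + (1 - p) * G (s - 1) = F s + m)
    (hG : ∀ s, (1 - q) * F (s + 1) + q * G (s - 1) = G s + m)
    (hFC : ∀ s ∈ Icc (-(B : ℝ)) A, |F s| ≤ C) (hGC : ∀ s ∈ Icc (-(B : ℝ)) A, |G s| ≤ C)
    (hn : 1 ≤ n) :
    Integrable ((surviveSet X A B n).indicator
        fun ω => stateValue X F G (n + 1) ω - stateValue X F G n ω) μ ∧
      ∫ ω, (surviveSet X A B n).indicator
        (fun ω => stateValue X F G (n + 1) ω - stateValue X F G n ω) ω ∂μ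
      = m * μ.real (surviveSet X A B n) := by
  set Y : Ω → ℝ := (surviveSet X A B n).indicator
    fun ω => F (partialSum X n ω + 1) - G (partialSum X n ω - 1) with hYdef
  have hS : Measurable[sigmaUpTo X n] (partialSum X n) := measurable_partialSum_sigmaUpTo le_rfl
  have hY : Measurable[sigmaUpTo X n] Y :=
    Measurable.indicator
      ((hFm.comp (hS.add_const 1)).sub (hGm.comp (hS.sub_const 1)))
      measurableSet_surviveSet_sigmaUpTo
  have hC0 : 0 ≤ C := (abs_nonneg _).trans
    (hFC 0 ⟨by linarith [(Nat.cast_nonneg B : (0 : ℝ) ≤ B)], Nat.cast_nonneg A⟩)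
  have hYC : ∀ ω, |Y ω| ≤ C + C := by
    intro ω
    by_cases h : ω ∈ surviveSet X A B n
    · obtain ⟨h1, h2⟩ := partialSum_bounds_of_mem_surviveSet hX.2.1 hA hB h
      rw [hYdef, indicator_of_mem h]
      exact (abs_sub _ _).trans (add_le_add (hFC _ ⟨by linarith, by linarith⟩)
        (hGC _ ⟨by linarith, by linarith⟩))
    · rw [hYdef, indicator_of_notMem h, abs_zero]
      linarith
  obtain ⟨hi, h0⟩ := hX.integral_mul_innovation hp0 hp1 hq0 hq1 hn hY hYC
  have hset : MeasurableSet (surviveSet X A B n) := measurableSet_surviveSet hX.1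
  have hi' : Integrable ((surviveSet X A B n).indicator fun _ => m) μ :=
    (integrable_const m).indicator hset
  have e : ((surviveSet X A B n).indicator
        fun ω => stateValue X F G (n + 1) ω - stateValue X F G n ω)
      = fun ω => (Y * innovation X p q n) ω + (surviveSet X A B n).indicator (fun _ => m) ω := by
    ext ω
    by_cases h : ω ∈ surviveSet X A B n
    · rw [Pi.mul_apply, hYdef]
      simp only [indicator_of_mem h]
      exact stateValue_succ_sub hX.2.1 hF hG hn
    · simp [hYdef, indicator_of_notMem h]
  rw [e]
  refine ⟨hi.add hi', ?_⟩
  rw [integral_add hi hi', h0, integral_indicator_const _ hset]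
  simp [mul_comm]

open Classical in
/-- Optional stopping at time `K + 1`, up to an error controlled by the survival probability. -/
lemma IsCRW.abs_optional_stopping_le [IsProbabilityMeasure μ] (hX : IsCRW μ X p q)
    (hp0 : 0 < p) (hp1 : p < 1) (hq0 : 0 < q) (hq1 : q < 1) (hA : 0 < A) (hB : 0 < B)
    {m : ℝ} {F G : ℝ → ℝ} (hFc : Continuous F) (hGc : Continuous G)
    (hF : ∀ s, p * F (s + 1) + (1 - p) * G (s - 1) = F s + m)
    (hG : ∀ s, (1 - q) * F (s + 1) + q * G (s - 1) = G s + m) :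
    ∃ C, ∀ K, |(1 - q) / (2 - p - q) * F 1 + (1 - p) / (2 - p - q) * G (-1)
        + m * ∑ k ∈ Finset.range K, μ.real (surviveSet X A B (k + 1))
        - (μ.real (exitUpper X A B) * F A + (1 - μ.real (exitUpper X A B)) * G (-(B : ℝ)))|
      ≤ C * μ.real (surviveSet X A B (K + 1)) := by
  obtain ⟨C₁, hC₁⟩ := (isCompact_Icc (a := -(B : ℝ)) (b := A)).exists_bound_of_continuousOn
    hFc.continuousOn
  obtain ⟨C₂, hC₂⟩ := (isCompact_Icc (a := -(B : ℝ)) (b := A)).exists_bound_of_continuousOn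
    hGc.continuousOn
  set C := max C₁ C₂
  have hFC : ∀ s ∈ Icc (-(B : ℝ)) A, |F s| ≤ C := fun s hs => (hC₁ s hs).trans (le_max_left _ _)
  have hGC : ∀ s ∈ Icc (-(B : ℝ)) A, |G s| ≤ C := fun s hs => (hC₂ s hs).trans (le_max_right _ _)
  have hA0 : (0 : ℝ) ≤ A := Nat.cast_nonneg A
  have hB0 : (0 : ℝ) ≤ B := Nat.cast_nonneg B
  refine ⟨C + C, fun K => ?_⟩
  obtain ⟨hi1, he1⟩ := hX.integral_stateValue_one hp1 hq1 F G
  have hstep := fun k => hX.integral_indicator_stateValue_sub hp0 hp1 hq0 hq1 hA hB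
    hFc.measurable hGc.measurable hF hG hFC hGC (Nat.le_add_left 1 k)
  have hE : MeasurableSet (exitUpper X A B) := measurableSet_exitUpper hX.1 hA hB
  have hS : MeasurableSet (surviveSet X A B (K + 1)) := measurableSet_surviveSet hX.1
  set V : Ω → ℝ := fun ω => (exitUpper X A B).indicator (fun _ => F A) ω
    + (exitUpper X A B)ᶜ.indicator (fun _ => G (-(B : ℝ))) ω
  have hV1 : Integrable ((exitUpper X A B).indicator fun _ => F A) μ :=
    (integrable_const _).indicator hE
  have hV2 : Integrable ((exitUpper X A B)ᶜ.indicator fun _ => G (-(B : ℝ))) μ :=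
    (integrable_const _).indicator hE.compl
  have hV : Integrable V μ := hV1.add hV2
  have hVint : ∫ ω, V ω ∂μ
      = μ.real (exitUpper X A B) * F A + (1 - μ.real (exitUpper X A B)) * G (-(B : ℝ)) := by
    rw [integral_add hV1 hV2, integral_indicator_const _ hE,
      integral_indicator_const _ hE.compl, probReal_compl_eq_one_sub hE]
    rfl
  set W : Ω → ℝ := fun ω => stateValue X F G 1 ω + ∑ k ∈ Finset.range K,
    (surviveSet X A B (k + 1)).indicator
      (fun ω => stateValue X F G (k + 2) ω - stateValue X F G (k + 1) ω) ω with hW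
  have hsum := integrable_finsetSum (Finset.range K) fun k _ => (hstep k).1
  have hWi : Integrable W μ := hi1.add hsum
  have hWint : ∫ ω, W ω ∂μ = (1 - q) / (2 - p - q) * F 1 + (1 - p) / (2 - p - q) * G (-1)
        + m * ∑ k ∈ Finset.range K, μ.real (surviveSet X A B (k + 1)) := by
    rw [hW, integral_add hi1 hsum, he1, integral_finsetSum _ fun k _ => (hstep k).1,
      Finset.mul_sum]
    exact congrArg _ (Finset.sum_congr rfl fun k _ => (hstep k).2)
  rw [← hWint, ← hVint, ← integral_sub hWi hV, mul_comm, ← smul_eq_mul,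
    ← integral_indicator_const _ hS, ← Real.norm_eq_abs]
  refine norm_integral_le_of_norm_le ((integrable_const (μ := μ) (C + C)).indicator hS)
    (Filter.Eventually.of_forall fun ω => ?_)
  have hVω : V ω = if ω ∈ exitUpper X A B then F A else G (-(B : ℝ)) := by
    by_cases h : ω ∈ exitUpper X A B <;> simp [V, h]
  have hWω : W ω = _ := stateValue_one_add_sum hX.2.1 hA hB F G ω K
  rw [hWω, hVω]
  by_cases h : ω ∈ surviveSet X A B (K + 1)
  · obtain ⟨h1, h2⟩ := partialSum_bounds_of_mem_surviveSet hX.2.1 hA hB h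
    have hmem : partialSum X (K + 1) ω ∈ Icc (-(B : ℝ)) A := ⟨by linarith, by linarith⟩
    rw [if_pos h, indicator_of_mem h]
    refine (norm_sub_le _ _).trans (add_le_add ?_ ?_)
    · rw [stateValue]
      split_ifs
      exacts [hFC _ hmem, hGC _ hmem]
    · split_ifs
      exacts [hFC _ ⟨by linarith, le_rfl⟩, hGC _ ⟨le_rfl, by linarith⟩]
  · rw [if_neg h, indicator_of_notMem h, sub_self, norm_zero]

lemma IsCRW.tendsto_measureReal_surviveSet [IsProbabilityMeasure μ] (hX : IsCRW μ X p q)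
    (hp0 : 0 < p) (hp1 : p < 1) (hq0 : 0 < q) (hq1 : q < 1) (hpq : p ≠ q)
    (hA : 0 < A) (hB : 0 < B) :
    Filter.Tendsto (fun n => μ.real (surviveSet X A B (n + 1))) Filter.atTop (nhds 0) := by
  have hd : 2 - p - q ≠ 0 := by linarith
  obtain ⟨C, hC⟩ := hX.abs_optional_stopping_le hp0 hp1 hq0 hq1 hA hB
    (m := (p - q) / (2 - p - q)) (F := fun s => s + (p + q - 1) / (2 - p - q))
    (G := fun s => s - (p + q - 1) / (2 - p - q)) (by fun_prop) (by fun_prop)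
    (fun s => by field_simp; ring) (fun s => by field_simp; ring)
  set m := (p - q) / (2 - p - q)
  have hm : 0 < |m| := abs_pos.2 (div_ne_zero (sub_ne_zero.2 hpq) hd)
  generalize (1 - q) / (2 - p - q) * (1 + (p + q - 1) / (2 - p - q))
    + (1 - p) / (2 - p - q) * (-1 - (p + q - 1) / (2 - p - q)) = a at hC
  generalize μ.real (exitUpper X A B) * ((A : ℝ) + (p + q - 1) / (2 - p - q))
    + (1 - μ.real (exitUpper X A B)) * (-(B : ℝ) - (p + q - 1) / (2 - p - q)) = b at hC
  refine (summable_of_sum_range_le (c := (|C| + |a - b|) / |m|)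
    (fun _ => measureReal_nonneg) fun K => ?_).tendsto_atTop_zero
  set T := ∑ k ∈ Finset.range K, μ.real (surviveSet X A B (k + 1))
  have hT : 0 ≤ T := Finset.sum_nonneg fun _ _ => measureReal_nonneg
  have h1 : C * μ.real (surviveSet X A B (K + 1)) ≤ |C| :=
    (mul_le_mul_of_nonneg_right (le_abs_self C) measureReal_nonneg).trans
      (mul_le_of_le_one_right (abs_nonneg C) measureReal_le_one)
  rw [le_div_iff₀ hm]
  calc T * |m| = |(a + m * T - b) - (a - b)| := by
        rw [show a + m * T - b - (a - b) = m * T by ring, abs_mul, abs_of_nonneg hT, mul_comm]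
    _ ≤ |a + m * T - b| + |a - b| := abs_sub _ _
    _ ≤ |C| + |a - b| := add_le_add_left ((hC K).trans h1) _

/-- The optional stopping identity for the exponential martingale. -/
lemma IsCRW.exponential_identity [IsProbabilityMeasure μ] (hX : IsCRW μ X p q)
    (hp0 : 0 < p) (hp1 : p < 1) (hq0 : 0 < q) (hq1 : q < 1) (hpq : p ≠ q)
    (hA : 0 < A) (hB : 0 < B) :
    (1 - p) * (1 - q) * (p + q) / (2 - p - q)
      = μ.real (exitUpper X A B) * ((q / p) ^ (A : ℝ) * ((1 - p) * p))
        + (1 - μ.real (exitUpper X A B)) * ((q / p) ^ (-(B : ℝ)) * ((1 - q) * q)) := by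
  have hr : 0 < q / p := div_pos hq0 hp0
  have hd : 2 - p - q ≠ 0 := by linarith
  have hc : Continuous fun s : ℝ => (q / p) ^ s := Real.continuous_const_rpow hr.ne'
  obtain ⟨C, hC⟩ := hX.abs_optional_stopping_le hp0 hp1 hq0 hq1 hA hB
    (m := 0) (F := fun s => (q / p) ^ s * ((1 - p) * p))
    (G := fun s => (q / p) ^ s * ((1 - q) * q)) (by fun_prop) (by fun_prop)
    (fun s => by rw [Real.rpow_add_one hr.ne', Real.rpow_sub_one hr.ne']; field_simp; ring)
    (fun s => by rw [Real.rpow_add_one hr.ne', Real.rpow_sub_one hr.ne']; field_simp; ring)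
  have hlim := ((hX.tendsto_measureReal_surviveSet hp0 hp1 hq0 hq1 hpq hA hB).const_mul C)
  rw [mul_zero] at hlim
  have h0 := abs_nonpos_iff.1 (ge_of_tendsto' hlim fun K => by
    simpa only [zero_mul, add_zero] using hC K)
  rw [sub_eq_zero] at h0
  rw [← h0, Real.rpow_one, Real.rpow_neg_one]
  field_simp
  ring

end Probability

lemma ruin_denominator_ne_zero {p q : ℝ} (hp0 : 0 < p) (hp1 : p < 1) (hq0 : 0 < q) (hq1 : q < 1)
    (hpq : p ≠ q) {A B : ℕ} (hA : 0 < A) (hB : 0 < B) :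
    (q / p) ^ (-(B : ℝ)) * ((1 - q) * q) - (q / p) ^ (A : ℝ) * ((1 - p) * p) ≠ 0 := by
  have hr : 0 < q / p := div_pos hq0 hp0
  have hA1 : (1 : ℝ) ≤ A := by exact_mod_cast hA
  have hB0 : (0 : ℝ) < B := by exact_mod_cast hB
  have e : (q / p) ^ (A : ℝ) * ((1 - p) * p) = (q / p) ^ ((A : ℝ) - 1) * ((1 - p) * q) := by
    rw [Real.rpow_sub_one hr.ne']
    field_simp
  rw [e, sub_ne_zero]
  have h1p : 0 < (1 - p) * q := mul_pos (by linarith) hq0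
  have h1q : 0 < (1 - q) * q := mul_pos (by linarith) hq0
  rcases lt_or_gt_of_ne hpq with h | h
  · have hr1 : 1 < q / p := (one_lt_div hp0).2 h
    refine (mul_lt_mul'' (Real.rpow_lt_rpow_of_exponent_lt hr1 (by linarith)) ?_
      (Real.rpow_pos_of_pos hr _).le h1q.le).ne
    nlinarith
  · have hr1 : q / p < 1 := (div_lt_one hp0).2 h
    refine (mul_lt_mul'' (Real.rpow_lt_rpow_of_exponent_gt hr hr1 (by linarith)) ?_
      (Real.rpow_pos_of_pos hr _).le h1p.le).ne'
    nlinarith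

/-- Ruin probability for the asymmetric two-state CRW (`p ≠ q`), started from the
stationary distribution: with `τ = inf{k : S_k = A or S_k = -B}`,
`α = P(S_τ = A)` is given by formula (7) of the paper. -/
theorem crw_asymmetric_ruin_probability
    (μ : Measure Ω) [IsProbabilityMeasure μ] (X : ℕ → Ω → ℝ) (p q : ℝ)
    (hp0 : 0 < p) (hp1 : p < 1) (hq0 : 0 < q) (hq1 : q < 1) (hpq : p ≠ q)
    (hX : IsCRW μ X p q)
    (A B : ℕ) (hA : 0 < A) (hB : 0 < B)
    (S : ℕ → Ω → ℝ) (hS : ∀ n ω, S n ω = ∑ i ∈ Finset.Icc 1 n, X i ω)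
    (τ : Ω → ℕ)
    (hτ : ∀ ω, τ ω = sInf {k | S k ω = (A : ℝ) ∨ S k ω = -(B : ℝ)}) :
    (μ {ω | S (τ ω) ω = (A : ℝ)}).toReal
      = ((q / p) ^ (-(B : ℝ)) * Real.sqrt ((1 - q) * q / ((1 - p) * p))
          - (Real.sqrt ((1 - q) * (1 - p)) / (2 - p - q))
            * (Real.sqrt (q / p) + Real.sqrt (p / q)))
        / ((q / p) ^ (-(B : ℝ)) * Real.sqrt ((1 - q) * q / ((1 - p) * p))
          - (q / p) ^ (A : ℝ) * Real.sqrt ((1 - p) * p / ((1 - q) * q))) := by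
  obtain rfl : S = partialSum X := funext fun n => funext fun ω => hS n ω
  obtain rfl : τ = exitTime X A B := funext hτ
  have key := hX.exponential_identity hp0 hp1 hq0 hq1 hpq hA hB
  have hden := ruin_denominator_ne_zero hp0 hp1 hq0 hq1 hpq hA hB
  change μ.real (exitUpper X A B) = _
  have hd : 2 - p - q ≠ 0 := by linarith
  have h1p : 0 < 1 - p := by linarith
  have h1q : 0 < 1 - q := by linarith
  generalize μ.real (exitUpper X A B) = α at key ⊢
  generalize (q / p) ^ (A : ℝ) = x at key hden ⊢
  generalize (q / p) ^ (-(B : ℝ)) = y at key hden ⊢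
  rw [Real.sqrt_div (mul_pos h1q hq0).le, Real.sqrt_div (mul_pos h1p hp0).le,
    Real.sqrt_div hq0.le, Real.sqrt_div hp0.le, Real.sqrt_mul h1q.le, Real.sqrt_mul h1p.le,
    Real.sqrt_mul h1q.le]
  obtain ⟨a, ha, rfl⟩ : ∃ a, 0 < a ∧ a ^ 2 = p := ⟨√p, by positivity, Real.sq_sqrt hp0.le⟩
  obtain ⟨b, hb, rfl⟩ : ∃ b, 0 < b ∧ b ^ 2 = q := ⟨√q, by positivity, Real.sq_sqrt hq0.le⟩
  have hc := Real.sq_sqrt h1p.le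
  have he := Real.sq_sqrt h1q.le
  have hc0 := Real.sqrt_pos.2 h1p
  have he0 := Real.sqrt_pos.2 h1q
  rw [Real.sqrt_sq ha.le, Real.sqrt_sq hb.le]
  generalize √(1 - a ^ 2) = c at hc hc0 ⊢
  generalize √(1 - b ^ 2) = e at he he0 ⊢
  rw [← hc, ← he] at key
  rw [← hc, ← he] at hden
  have hD : y * (e * b / (c * a)) - x * (c * a / (e * b))
      = (y * (e ^ 2 * b ^ 2) - x * (c ^ 2 * a ^ 2)) / (c * a * e * b) := by
    field_simp
  have hN : y * (e * b / (c * a)) - e * c / (2 - a ^ 2 - b ^ 2) * (b / a + a / b)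
      = (y * (e ^ 2 * b ^ 2) - c ^ 2 * e ^ 2 * (a ^ 2 + b ^ 2) / (2 - a ^ 2 - b ^ 2))
        / (c * a * e * b) := by
    field_simp
    ring
  rw [hD, hN, div_div_div_cancel_right₀ (by positivity), eq_div_iff hden, key]
  ring
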